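/- Let τ, η ∈ OP_n with τ̄ ≤ η̄. Then there exists an ordered set partition σ_max ∈ OP_n such that {σ ∈ OP_n : σ ≥ τ and σ̄ ≤ η̄} = {σ ∈ OP_n : τ ≤ σ ≤ σ_max}; moreover this set, with the order induced from OP_n, is order-isomorphic to the product poset IP_{q_1} × IP_{q_2} × ⋯ × IP_{q_r}, where q_1,…,q_r are the lengths of the level runs of the sequence (m_1,…,m_s) and r = |τ| − plat_η(τ). -/

import Mathlib

open Finset

namespace OSPpaper

/-- A *block* is a subset of `[n] = Fin n`. -/
abbrev Block (n : ℕ) := Finset (Fin n)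

/-- `l` is an ordered set partition of the ground set `E ⊆ [n]`:
a finite sequence of pairwise disjoint nonempty subsets of `E` whose union is `E`. -/
def IsOSP {n : ℕ} (E : Finset (Fin n)) (l : List (Block n)) : Prop :=
  (∀ P ∈ l, P.Nonempty) ∧ l.Pairwise (fun P Q => Disjoint P Q) ∧
    (∀ P ∈ l, P ⊆ E) ∧ ∀ i ∈ E, ∃ P ∈ l, i ∈ P

/-- Union of a list of blocks. -/
def unionList {n : ℕ} (l : List (Block n)) : Block n := l.foldr (· ∪ ·) ∅

/-- The order on ordered set partitions: `π ≤ σ` iff every block of `σ` is the union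
of a contiguous run of blocks of `π` (runs taken in order). -/
def OSPle {n : ℕ} (π σ : List (Block n)) : Prop :=
  ∃ L : List (List (Block n)), L.flatten = π ∧ σ = L.map unionList

/-- The restriction `σ⌋_P`: intersect every block with `P` and delete the empty intersections. -/
def restrict {n : ℕ} (σ : List (Block n)) (P : Block n) : List (Block n) :=
  (σ.map (fun Q => Q ∩ P)).filter (fun Q => decide (Q ≠ ∅))

/-- The quasi-meet `π ⋏ σ`: the concatenation `σ⌋_{P₁} σ⌋_{P₂} ⋯ σ⌋_{P_p}`. -/
def qmeet {n : ℕ} (π σ : List (Block n)) : List (Block n) :=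
  (π.map (fun P => restrict σ P)).flatten

/-- Refinement: every block of `σ` is contained in some block of `τ`.
(As a relation on the underlying unordered partitions, this is the refinement order;
in particular `refines τ η` says `τ̄ ≤ η̄`.) -/
def refines {n : ℕ} (σ τ : List (Block n)) : Prop := ∀ P ∈ σ, ∃ Q ∈ τ, P ⊆ Q

/-- An interval partition of `[m]`, with its blocks listed in (the unique) increasing order:
an ordered set partition whose consecutive blocks are completely ordered. -/
def IsIP {m : ℕ} (l : List (Finset (Fin m))) : Prop :=
  IsOSP Finset.univ l ∧ l.Chain' (fun P Q => ∀ a ∈ P, ∀ b ∈ Q, a < b)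

/-- The (0-based) index `π(k)` of the block of `π` containing `k`. -/
def blockIdx {n : ℕ} (π : List (Block n)) (k : Fin n) : ℕ :=
  π.findIdx (fun P => decide (k ∈ P))

/-- The ordered kernel `κ(i₁,…,iₙ)` of a tuple: the nonempty level sets of the tuple,
listed in increasing order of the value. -/
def kernel {n : ℕ} (i : Fin n → ℕ) : List (Block n) :=
  ((Finset.image i Finset.univ).sort (· ≤ ·)).map
    (fun v => Finset.univ.filter (fun k => i k = v))

/-- `[σ:π] = ∏_{P ∈ π} #(σ⌋_P)`. -/
def colonNum {n : ℕ} (σ π : List (Block n)) : ℕ :=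
  (π.map (fun P => (restrict σ P).length)).prod

/-- `[σ:π]! = ∏_{P ∈ π} #(σ⌋_P)!`. -/
def colonFac {n : ℕ} (σ π : List (Block n)) : ℕ :=
  (π.map (fun P => Nat.factorial (restrict σ P).length)).prod

/-- For `τ̄ ≤ η̄` the sequence `(m_1,…,m_s)`: `m_i` is the (0-based) index of the block of `η`
containing the `i`-th block of `τ`. -/
def mseq {n : ℕ} (τ η : List (Block n)) : List ℕ :=
  τ.map (fun T => η.findIdx (fun E => decide (T ⊆ E)))

/-- number of ascents of a sequence -/
def ascL (l : List ℕ) : ℕ := ((l.zip l.tail).filter (fun p => decide (p.1 < p.2))).length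
/-- number of descents of a sequence -/
def desL (l : List ℕ) : ℕ := ((l.zip l.tail).filter (fun p => decide (p.2 < p.1))).length
/-- number of plateaux of a sequence -/
def platL (l : List ℕ) : ℕ := ((l.zip l.tail).filter (fun p => decide (p.1 = p.2))).length

/-- `asc_η(τ)` -/
def ascN {n : ℕ} (τ η : List (Block n)) : ℕ := ascL (mseq τ η)
/-- `des_η(τ)` -/
def desN {n : ℕ} (τ η : List (Block n)) : ℕ := desL (mseq τ η)
/-- `plat_η(τ)` -/
def platN {n : ℕ} (τ η : List (Block n)) : ℕ := platL (mseq τ η)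

/-- lengths of the maximal ascending runs of a sequence -/
def ascRunLengths (l : List ℕ) : List ℕ :=
  (l.splitBy (fun a b => decide (a < b))).map List.length
/-- lengths of the maximal level (constant) runs of a sequence -/
def levelRunLengths (l : List ℕ) : List ℕ :=
  (l.splitBy (fun a b => decide (a = b))).map List.length

/-- `μ̃(σ,π) = (−1)^{|σ|−|π|} / [σ:π]` (real-valued). -/
noncomputable def muR {n : ℕ} (σ π : List (Block n)) : ℝ :=
  (-1 : ℝ) ^ (σ.length - π.length) / (colonNum σ π : ℝ)

/-- `ζ̃(σ,π) = 1 / [σ:π]!` (real-valued). -/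
noncomputable def zetaR {n : ℕ} (σ π : List (Block n)) : ℝ :=
  1 / (colonFac σ π : ℝ)

/-- The Weisner coefficient `w(τ,η) = ∑_{σ ⋏ η = τ} μ̃(σ, 1̂ₙ)`. -/
noncomputable def wcoef {n : ℕ} (τ η : List (Block n)) : ℝ :=
  ∑ᶠ σ ∈ {σ : List (Block n) | IsOSP Finset.univ σ ∧ qmeet σ η = τ},
    muR σ [(Finset.univ : Block n)]

/-- The Goldberg coefficient `g(τ,η) = ∑_{σ ≥ τ} ζ̃(τ,σ) w(σ,η)`. -/
noncomputable def gcoef {n : ℕ} (τ η : List (Block n)) : ℝ :=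
  ∑ᶠ σ ∈ {σ : List (Block n) | IsOSP Finset.univ σ ∧ OSPle τ σ}, zetaR τ σ * wcoef σ η


lemma mem_unionList {n : ℕ} {l : List (Block n)} {x : Fin n} :
    x ∈ unionList l ↔ ∃ P ∈ l, x ∈ P := by
  induction l with
  | nil => simp [unionList]
  | cons A l ih =>
    have h : unionList (A :: l) = A ∪ unionList l := rfl
    simp [h, ih]

section Blocks

variable {n : ℕ} {σ σ' : List (Block n)}

lemma IsOSP.blockIdx_lt (h : IsOSP univ σ) (x : Fin n) : blockIdx σ x < σ.length := by
  obtain ⟨P, hP, hx⟩ := h.2.2.2 x (mem_univ x)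
  exact List.findIdx_lt_length_of_exists ⟨P, hP, by simpa using hx⟩

lemma blockIdx_getElem {x : Fin n} (hx : blockIdx σ x < σ.length) : x ∈ σ[blockIdx σ x] :=
  of_decide_eq_true (List.findIdx_getElem (w := hx))

lemma IsOSP.blockIdx_eq (h : IsOSP univ σ) {i : ℕ} (hi : i < σ.length) {x : Fin n}
    (hx : x ∈ σ[i]) : blockIdx σ x = i := by
  by_contra hne
  have hlt := h.blockIdx_lt x
  have hx' := blockIdx_getElem hlt
  rcases lt_or_gt_of_ne hne with hl | hl
  · exact Finset.disjoint_left.1 (List.pairwise_iff_getElem.1 h.2.1 _ _ hlt hi hl) hx' hx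
  · exact Finset.disjoint_left.1 (List.pairwise_iff_getElem.1 h.2.1 _ _ hi hlt hl) hx hx'

lemma IsOSP.mem_block_iff (h : IsOSP univ σ) {P : Block n} (hP : P ∈ σ) {x : Fin n}
    (hx : x ∈ P) (y : Fin n) : y ∈ P ↔ blockIdx σ y = blockIdx σ x := by
  obtain ⟨i, hi, rfl⟩ := List.mem_iff_getElem.1 hP
  rw [h.blockIdx_eq hi hx]
  refine ⟨h.blockIdx_eq hi, ?_⟩
  rintro rfl
  exact blockIdx_getElem hi

lemma IsOSP.mem_iff_exists (h : IsOSP univ σ) {P : Block n} :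
    P ∈ σ ↔ ∃ x, P = univ.filter (fun y => blockIdx σ y = blockIdx σ x) := by
  constructor
  · intro hP
    obtain ⟨x, hx⟩ := h.1 P hP
    exact ⟨x, by ext y; simp [h.mem_block_iff hP hx]⟩
  · rintro ⟨x, rfl⟩
    obtain ⟨P, hP, hx⟩ := h.2.2.2 x (mem_univ x)
    convert hP
    ext y; simp [h.mem_block_iff hP hx]

lemma IsOSP.pairwise_blockIdx_lt (h : IsOSP univ σ) :
    σ.Pairwise (fun P Q => ∀ x ∈ P, ∀ y ∈ Q, blockIdx σ x < blockIdx σ y) := by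
  rw [List.pairwise_iff_getElem]
  intro i j hi hj hij x hx y hy
  rwa [h.blockIdx_eq hi hx, h.blockIdx_eq hj hy]

/-- Two lists of nonempty blocks with the same members, both arranged so that `f` strictly
increases from block to block, are equal. -/
lemma eq_of_pairwise_lt_of_mem_iff {f : Fin n → ℕ} {l l' : List (Block n)}
    (hne : ∀ P ∈ l, P.Nonempty)
    (hl : l.Pairwise (fun P Q => ∀ x ∈ P, ∀ y ∈ Q, f x < f y))
    (hl' : l'.Pairwise (fun P Q => ∀ x ∈ P, ∀ y ∈ Q, f x < f y))
    (hmem : ∀ P, P ∈ l ↔ P ∈ l') : l = l' := by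
  let r : Block n → Block n → Prop := fun P Q =>
    P.Nonempty ∧ Q.Nonempty ∧ ∀ x ∈ P, ∀ y ∈ Q, f x < f y
  have : Std.Irrefl r := ⟨fun P ⟨⟨x, hx⟩, _, h⟩ => lt_irrefl _ (h x hx x hx)⟩
  have : Std.Antisymm r := ⟨fun P Q ⟨⟨x, hx⟩, ⟨y, hy⟩, h⟩ ⟨_, _, h'⟩ =>
    absurd (h x hx y hy) (h' y hy x hx).not_gt⟩
  refine List.Pairwise.eq_of_mem_iff (r := r) ?_ ?_ hmem
  · exact hl.imp_of_mem fun hP hQ h => ⟨hne _ hP, hne _ hQ, h⟩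
  · exact hl'.imp_of_mem fun hP hQ h =>
      ⟨hne _ ((hmem _).2 hP), hne _ ((hmem _).2 hQ), h⟩

lemma IsOSP.blockIdx_le_of_OSPle (h : IsOSP univ σ) (h' : IsOSP univ σ') (hle : OSPle σ σ')
    {x y : Fin n} (hxy : blockIdx σ x ≤ blockIdx σ y) : blockIdx σ' x ≤ blockIdx σ' y := by
  obtain ⟨L, rfl, rfl⟩ := hle
  by_contra! hlt
  have hx := h'.blockIdx_lt x
  have hy := h'.blockIdx_lt y
  have hx' := blockIdx_getElem hx
  have hy' := blockIdx_getElem hy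
  rw [List.getElem_map, mem_unionList] at hx' hy'
  obtain ⟨P, hP, hxP⟩ := hx'
  obtain ⟨Q, hQ, hyQ⟩ := hy'
  have hpw := List.pairwise_iff_getElem.1 (List.pairwise_flatten.1 h.pairwise_blockIdx_lt).2
    _ _ (by simpa using hy) (by simpa using hx) hlt
  exact (hpw Q hQ P hP y hyQ x hxP).not_ge hxy

lemma IsOSP.OSPle_of_blockIdx_le (h : IsOSP univ σ) (h' : IsOSP univ σ')
    (hle : ∀ x y, blockIdx σ x ≤ blockIdx σ y → blockIdx σ' x ≤ blockIdx σ' y) :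
    OSPle σ σ' := by
  have hmono : ∀ P ∈ σ, ∃ Q ∈ σ', P ⊆ Q := by
    intro P hP
    obtain ⟨x, hx⟩ := h.1 P hP
    obtain ⟨Q, hQ, hxQ⟩ := h'.2.2.2 x (mem_univ x)
    refine ⟨Q, hQ, fun y hy => ?_⟩
    have := (h.mem_block_iff hP hx y).1 hy
    exact (h'.mem_block_iff hQ hxQ y).2 (le_antisymm (hle _ _ this.le) (hle _ _ this.ge))
  refine ⟨σ'.map (fun Q => σ.filter (fun P => decide (P ⊆ Q))), ?_, ?_⟩
  · refine eq_of_pairwise_lt_of_mem_iff (f := blockIdx σ) ?_ ?_ h.pairwise_blockIdx_lt ?_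
    · intro P hP
      simp only [List.mem_flatten, List.mem_map] at hP
      obtain ⟨_, ⟨Q, _, rfl⟩, hP⟩ := hP
      exact h.1 P (List.mem_of_mem_filter hP)
    · refine List.pairwise_flatten.2 ⟨?_, ?_⟩
      · simp only [List.mem_map]
        rintro _ ⟨Q, _, rfl⟩
        exact h.pairwise_blockIdx_lt.filter _
      · refine List.pairwise_map.2 (h'.pairwise_blockIdx_lt.imp ?_)
        intro Q Q' hQ P hP P' hP' x hx y hy
        simp only [List.mem_filter, decide_eq_true_eq] at hP hP'
        by_contra! hlt
        exact (hQ x (hP.2 hx) y (hP'.2 hy)).not_ge (hle _ _ hlt)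
    · intro P
      simp only [List.mem_flatten, List.mem_map]
      constructor
      · rintro ⟨_, ⟨Q, _, rfl⟩, hP⟩
        exact List.mem_of_mem_filter hP
      · intro hP
        obtain ⟨Q, hQ, hPQ⟩ := hmono P hP
        exact ⟨_, ⟨Q, hQ, rfl⟩, by simp [hP, hPQ]⟩
  · rw [List.map_map]
    conv_lhs => rw [← List.map_id σ']
    refine List.map_congr_left fun Q hQ => ?_
    ext x
    simp only [id, Function.comp, mem_unionList, List.mem_filter, decide_eq_true_eq]
    constructor
    · intro hx
      obtain ⟨P, hP, hxP⟩ := h.2.2.2 x (mem_univ x)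
      obtain ⟨Q', hQ', hPQ⟩ := hmono P hP
      refine ⟨P, ⟨hP, fun y hy => ?_⟩, hxP⟩
      rw [h'.mem_block_iff hQ hx, ← h'.mem_block_iff hQ' (hPQ hxP)]
      exact hPQ hy
    · rintro ⟨P, ⟨_, hPQ⟩, hx⟩
      exact hPQ hx

lemma IsOSP.OSPle_iff (h : IsOSP univ σ) (h' : IsOSP univ σ') :
    OSPle σ σ' ↔ ∀ x y, blockIdx σ x ≤ blockIdx σ y → blockIdx σ' x ≤ blockIdx σ' y :=
  ⟨fun hle _ _ => h.blockIdx_le_of_OSPle h' hle, h.OSPle_of_blockIdx_le h'⟩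

lemma IsOSP.refines_iff (h : IsOSP univ σ) (h' : IsOSP univ σ') :
    refines σ σ' ↔ ∀ x y, blockIdx σ x = blockIdx σ y → blockIdx σ' x = blockIdx σ' y := by
  constructor
  · intro hr x y hxy
    obtain ⟨P, hP, hy⟩ := h.2.2.2 y (mem_univ y)
    obtain ⟨Q, hQ, hPQ⟩ := hr P hP
    exact (h'.mem_block_iff hQ (hPQ hy) x).1 (hPQ ((h.mem_block_iff hP hy x).2 hxy))
  · intro hr P hP
    obtain ⟨x, hx⟩ := h.1 P hP
    obtain ⟨Q, hQ, hxQ⟩ := h'.2.2.2 x (mem_univ x)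
    exact ⟨Q, hQ, fun y hy =>
      (h'.mem_block_iff hQ hxQ y).2 (hr _ _ ((h.mem_block_iff hP hx y).1 hy))⟩

/-- An ordered set partition is determined by the total preorder it induces. -/
lemma IsOSP.eq_of_blockIdx_le_iff (h : IsOSP univ σ) (h' : IsOSP univ σ')
    (hle : ∀ x y, blockIdx σ x ≤ blockIdx σ y ↔ blockIdx σ' x ≤ blockIdx σ' y) : σ = σ' := by
  refine eq_of_pairwise_lt_of_mem_iff h.1 h.pairwise_blockIdx_lt
    (h'.pairwise_blockIdx_lt.imp fun hPQ x hx y hy => ?_) fun P => ?_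
  · exact lt_of_not_ge fun hc => (hPQ x hx y hy).not_ge ((hle _ _).1 hc)
  · simp only [h.mem_iff_exists, h'.mem_iff_exists, le_antisymm_iff, hle]

/-- If `σ` and `σ'` both coarsen `τ`, then `σ ≤ σ'` as soon as `σ` refines `σ'`. -/
lemma IsOSP.OSPle_of_refines {τ : List (Block n)} (hτ : IsOSP univ τ) (h : IsOSP univ σ)
    (h' : IsOSP univ σ') (hle : OSPle τ σ) (hle' : OSPle τ σ') (hr : refines σ σ') :
    OSPle σ σ' := by
  rw [hτ.OSPle_iff h] at hle
  rw [hτ.OSPle_iff h'] at hle'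
  rw [h.refines_iff h'] at hr
  refine h.OSPle_of_blockIdx_le h' fun x y hxy => ?_
  rcases hxy.eq_or_lt with heq | hlt
  · exact (hr x y heq).le
  · refine hle' x y ?_
    by_contra! hc
    exact hlt.not_ge (hle y x hc.le)

lemma IsOSP.refines_of_OSPle (h : IsOSP univ σ) (h' : IsOSP univ σ') (hle : OSPle σ σ') :
    refines σ σ' := by
  rw [h.OSPle_iff h'] at hle
  exact (h.refines_iff h').2 fun x y hxy => le_antisymm (hle _ _ hxy.le) (hle _ _ hxy.ge)

lemma isOSP_kernel (f : Fin n → ℕ) : IsOSP univ (kernel f) := by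
  refine ⟨?_, ?_, fun _ _ => subset_univ _, fun x _ => ?_⟩
  · simp only [kernel, List.mem_map, mem_sort, mem_image]
    rintro _ ⟨_, ⟨x, _, rfl⟩, rfl⟩
    exact ⟨x, by simp⟩
  · refine List.pairwise_map.2 ((sort_nodup _ _).imp fun {a b} hab => ?_)
    refine Finset.disjoint_left.2 fun x hx hx' => hab ?_
    simp only [mem_filter] at hx hx'
    exact hx.2.symm.trans hx'.2
  · exact ⟨univ.filter (fun k => f k = f x),
      List.mem_map.2 ⟨f x, by simp, rfl⟩, by simp⟩

lemma pairwise_kernel (f : Fin n → ℕ) :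
    (kernel f).Pairwise (fun P Q => ∀ x ∈ P, ∀ y ∈ Q, f x < f y) := by
  refine List.pairwise_map.2 ((sortedLT_sort (univ.image f)).pairwise.imp fun {a b} hab => ?_)
  intro x hx y hy
  simp only [mem_filter] at hx hy
  rwa [hx.2, hy.2]

lemma blockIdx_kernel_le_iff (f : Fin n → ℕ) (x y : Fin n) :
    blockIdx (kernel f) x ≤ blockIdx (kernel f) y ↔ f x ≤ f y := by
  have h := isOSP_kernel f
  have key : ∀ x y, blockIdx (kernel f) x < blockIdx (kernel f) y → f x < f y := fun x y hlt =>
    List.pairwise_iff_getElem.1 (pairwise_kernel f) _ _ (h.blockIdx_lt x) (h.blockIdx_lt y) hlt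
      x (blockIdx_getElem _) y (blockIdx_getElem _)
  constructor
  · intro hle
    rcases hle.eq_or_lt with heq | hlt
    · obtain ⟨P, hP, hy⟩ := h.2.2.2 y (mem_univ y)
      have hx := (h.mem_block_iff hP hy x).2 heq
      obtain ⟨v, _, rfl⟩ := List.mem_map.1 hP
      simp only [mem_filter] at hx hy
      exact (hx.2.trans hy.2.symm).le
    · exact (key x y hlt).le
  · intro hle
    by_contra! hc
    exact (key y x hc).not_ge hle

lemma blockIdx_kernel_eq_iff (f : Fin n → ℕ) (x y : Fin n) :
    blockIdx (kernel f) x = blockIdx (kernel f) y ↔ f x = f y := by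
  simp only [le_antisymm_iff, blockIdx_kernel_le_iff]

/-- Interval partitions are the ordered set partitions whose block index is monotone. -/
lemma isIP_iff {l : List (Block n)} :
    IsIP l ↔ IsOSP univ l ∧ ∀ x y, x ≤ y → blockIdx l x ≤ blockIdx l y := by
  refine and_congr_right fun h => ?_
  constructor
  · intro hc x y hxy
    let r : Block n → Block n → Prop := fun P Q =>
      P.Nonempty ∧ Q.Nonempty ∧ ∀ a ∈ P, ∀ b ∈ Q, a < b
    have : Trans r r r := ⟨fun {P Q R} ⟨hP, ⟨y, hy⟩, h⟩ ⟨_, hR, h'⟩ =>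
      ⟨hP, hR, fun a ha b hb => (h a ha y hy).trans (h' y hy b hb)⟩⟩
    have hpw : l.Pairwise r := by
      refine List.isChain_iff_pairwise.1 ?_
      rw [List.isChain_iff_getElem]
      intro i hi
      exact ⟨h.1 _ (List.getElem_mem _), h.1 _ (List.getElem_mem _),
        List.isChain_iff_getElem.1 hc i hi⟩
    by_contra! hlt
    exact ((List.pairwise_iff_getElem.1 hpw _ _ (h.blockIdx_lt y) (h.blockIdx_lt x) hlt).2.2
      y (blockIdx_getElem _) x (blockIdx_getElem _)).not_ge hxy
  · intro hm
    refine List.Pairwise.isChain (h.pairwise_blockIdx_lt.imp fun hPQ a ha b hb => ?_)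
    by_contra! hc
    exact (hPQ a ha b hb).not_ge (hm _ _ hc)

end Blocks

section LevelRuns

lemma platL_cons_cons (a b : ℕ) (l : List ℕ) :
    platL (a :: b :: l) = (if a = b then 1 else 0) + platL (b :: l) := by
  by_cases h : a = b <;> simp [platL, h, add_comm]

lemma length_splitByLoop_add_platL (l : List ℕ) (a : ℕ) (g : List ℕ) (gs : List (List ℕ)) :
    (List.splitBy.loop (fun a b => decide (a = b)) l a g gs).length + platL (a :: l)
      = gs.length + 1 + l.length := by
  induction l generalizing a g gs with
  | nil => simp [List.splitBy.loop, platL]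
  | cons b l ih =>
    rw [platL_cons_cons, List.splitBy.loop]
    by_cases h : a = b
    · have := ih b (a :: g) gs
      simp only [h, decide_true, if_true, List.length_cons] at this ⊢
      omega
    · have := ih b [] ((a :: g).reverse :: gs)
      simp only [h, decide_false, if_false, List.length_cons] at this ⊢
      omega

lemma length_levelRunLengths (l : List ℕ) :
    (levelRunLengths l).length = l.length - platL l := by
  cases l with
  | nil => simp [levelRunLengths]
  | cons a l =>
    have := length_splitByLoop_add_platL l a [] []
    simp only [levelRunLengths, List.length_map, List.splitBy, List.length_cons] at this ⊢
    simp only [List.length_nil] at this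
    omega

/-- The composition of the length of a sequence given by its level runs. -/
def levelRunComposition (l : List ℕ) : Composition l.length where
  blocks := levelRunLengths l
  blocks_pos := by
    intro i hi
    obtain ⟨g, hg, rfl⟩ := List.mem_map.1 hi
    exact List.length_pos_iff.2 (List.ne_nil_of_mem_splitBy hg)
  blocks_sum := by
    rw [levelRunLengths, ← List.length_flatten, List.flatten_splitBy]

variable {l : List ℕ}

lemma getElem_splitBy_levelRun (j : Fin (levelRunComposition l).length) :
    (l.splitBy (fun a b => decide (a = b)))[(j : ℕ)]'(by
      simpa [levelRunComposition, levelRunLengths, Composition.length] using j.2) =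
    (l.take ((levelRunComposition l).sizeUpTo (j + 1))).drop
      ((levelRunComposition l).sizeUpTo j) := by
  have h := List.drop_take_succ_flatten_eq_getElem
    (l.splitBy (fun a b => decide (a = b))) j (by
      simpa [levelRunComposition, levelRunLengths, Composition.length] using j.2)
  rw [List.flatten_splitBy] at h
  exact h.symm

lemma getElem_eq_of_index_eq {i i' : Fin l.length}
    (h : (levelRunComposition l).index i = (levelRunComposition l).index i') :
    l[i] = l[i'] := by
  set c := levelRunComposition l with hc
  set j := c.index i with hj
  have hG := getElem_splitBy_levelRun j
  simp only [← hc] at hG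
  set G := (l.splitBy (fun a b => decide (a = b)))[(j : ℕ)]'(by
      simpa [c, levelRunComposition, levelRunLengths, Composition.length] using j.2) with hGdef
  have hchain : G.IsChain (fun x y => x = y) := by
    have := List.isChain_of_mem_splitBy (r := fun a b => decide (a = b)) (l := l) (m := G)
      (List.getElem_mem _)
    simpa only [decide_eq_true_eq] using this
  have hpw := List.isChain_iff_pairwise.1 hchain
  have key : ∀ k : Fin l.length, c.index k = j → l[k] ∈ G := by
    intro k hk
    have h1 : c.sizeUpTo j ≤ k := hk ▸ c.sizeUpTo_index_le k
    have h2 : (k : ℕ) < c.sizeUpTo (j + 1) := hk ▸ c.lt_sizeUpTo_index_succ k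
    rw [hG, List.mem_iff_getElem]
    refine ⟨k - c.sizeUpTo j, ?_, ?_⟩
    · simp only [List.length_drop, List.length_take]
      have := k.2
      omega
    · simp [h1]
  have : Std.Symm (fun x y : ℕ => x = y) := ⟨fun _ _ h => h.symm⟩
  exact hpw.forall_of_forall (R := fun x y : ℕ => x = y) (fun _ _ => rfl)
    (key i rfl) (key i' h.symm)

lemma index_eq_of_getElem_eq {i : ℕ} (hi : i + 1 < l.length) (h : l[i] = l[i + 1]) :
    (levelRunComposition l).index ⟨i, by omega⟩ = (levelRunComposition l).index ⟨i + 1, hi⟩ := by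
  set c := levelRunComposition l with hc
  set j := c.index ⟨i, by omega⟩ with hj
  set j' := c.index ⟨i + 1, hi⟩ with hj'
  have h1 : c.sizeUpTo j ≤ i := c.sizeUpTo_index_le ⟨i, by omega⟩
  have h2 : i < c.sizeUpTo (j + 1) := c.lt_sizeUpTo_index_succ ⟨i, by omega⟩
  have h3 : c.sizeUpTo j' ≤ i + 1 := c.sizeUpTo_index_le ⟨i + 1, hi⟩
  have h4 : i + 1 < c.sizeUpTo (j' + 1) := c.lt_sizeUpTo_index_succ ⟨i + 1, hi⟩
  by_contra hne
  have hlt : (j : ℕ) < j' := by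
    by_contra! hle
    have := c.monotone_sizeUpTo (show (j' : ℕ) + 1 ≤ j from
      lt_of_le_of_ne hle fun he => hne (Fin.ext he.symm))
    omega
  have hjj : (j' : ℕ) = j + 1 := by
    by_contra hc'
    have := c.sizeUpTo_strict_mono (show (j : ℕ) + 1 < c.length by omega)
    have := c.monotone_sizeUpTo (show (j : ℕ) + 1 + 1 ≤ j' by omega)
    omega
  have hend : c.sizeUpTo (j + 1) = i + 1 := by rw [hjj] at h3; omega
  have hG := getElem_splitBy_levelRun j
  have hG' := getElem_splitBy_levelRun j'
  have hlen : (j : ℕ) + 1 < (l.splitBy (fun a b => decide (a = b))).length := by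
    have := j'.2
    rw [hjj] at this
    simpa [c, levelRunComposition, levelRunLengths, Composition.length] using this
  obtain ⟨ha, hb, hab⟩ := List.isChain_iff_getElem.1
    (List.isChain_getLast_head_splitBy (fun a b => decide (a = b)) l) j hlen
  rw [decide_eq_false_iff_not] at hab
  apply hab
  simp only [hjj] at hG'
  have e1 : ((l.take (i + 1)).drop (c.sizeUpTo j)).length - 1 = i - c.sizeUpTo j := by
    simp only [List.length_drop, List.length_take]
    omega
  simp only [hG, hG', ← hc, List.getLast_eq_getElem, List.head_eq_getElem, List.getElem_drop,
    List.getElem_take, hend, e1, h1, Nat.add_sub_cancel', Nat.add_zero]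
  exact h

lemma index_mono {m : ℕ} (c : Composition m) {i i' : Fin m} (h : i ≤ i') :
    c.index i ≤ c.index i' := by
  by_contra! hlt
  have h1 := c.sizeUpTo_index_le i
  have h2 := c.lt_sizeUpTo_index_succ i'
  have h3 := c.monotone_sizeUpTo (Nat.succ_le_of_lt (Fin.lt_def.1 hlt))
  have h4 := Fin.le_def.1 h
  simp only [Fin.val_succ, Nat.succ_eq_add_one] at h2 h3
  omega

lemma index_eq_of_forall_getElem_eq {a b : ℕ} (hab : a ≤ b) (hb : b < l.length)
    (h : ∀ i (_ : a ≤ i) (hi : i ≤ b), l[i] = l[a]) :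
    (levelRunComposition l).index ⟨a, by omega⟩ = (levelRunComposition l).index ⟨b, hb⟩ := by
  induction b, hab using Nat.le_induction with
  | base => rfl
  | succ b hab ih =>
    rw [ih (by omega) fun i h1 h2 => h i h1 (by omega)]
    exact index_eq_of_getElem_eq hb ((h b hab (by omega)).trans (h (b + 1) (by omega) le_rfl).symm)

end LevelRuns

section Coarsenings

variable {n : ℕ} {τ η σ : List (Block n)}

lemma length_mseq (τ η : List (Block n)) : (mseq τ η).length = τ.length :=
  List.length_map _

lemma getElem_mseq (hη : IsOSP univ η) (hbar : refines τ η) {i : ℕ} (hi : i < τ.length)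
    {x : Fin n} (hx : x ∈ τ[i]) :
    (mseq τ η)[i]'(by rwa [length_mseq]) = blockIdx η x := by
  simp only [mseq, List.getElem_map, blockIdx]
  obtain ⟨Q, hQ, hPQ⟩ := hbar _ (List.getElem_mem hi)
  refine le_antisymm (List.findIdx_le_findIdx fun E hE hxE => ?_)
    (List.findIdx_le_findIdx fun E hE hTE => ?_)
  · simp only [decide_eq_true_eq] at hxE ⊢
    intro y hy
    rw [hη.mem_block_iff hE hxE, ← hη.mem_block_iff hQ (hPQ hx)]
    exact hPQ hy
  · simp only [decide_eq_true_eq] at hTE ⊢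
    exact hTE hx

/-- The position in `mseq τ η` of the block of `τ` containing a given element. -/
def blockPos (hτ : IsOSP univ τ) (η : List (Block n)) (x : Fin n) : Fin (mseq τ η).length :=
  ⟨blockIdx τ x, by rw [length_mseq]; exact hτ.blockIdx_lt x⟩

lemma getElem_blockPos (hτ : IsOSP univ τ) (hη : IsOSP univ η) (hbar : refines τ η) (x : Fin n) :
    (mseq τ η)[blockPos hτ η x] = blockIdx η x :=
  getElem_mseq hη hbar (hτ.blockIdx_lt x) (blockIdx_getElem _)

lemma blockPos_surjective (hτ : IsOSP univ τ) (η : List (Block n)) :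
    Function.Surjective (blockPos hτ η) := by
  rintro ⟨i, hi⟩
  have hi' : i < τ.length := by rwa [length_mseq] at hi
  obtain ⟨x, hx⟩ := hτ.1 _ (List.getElem_mem hi')
  exact ⟨x, Fin.ext (hτ.blockIdx_eq hi' hx)⟩

/-- The index of the level run of `mseq τ η` containing the `τ`-block of a given element. -/
def runIdx (hτ : IsOSP univ τ) (η : List (Block n)) (x : Fin n) :
    Fin (levelRunComposition (mseq τ η)).length :=
  (levelRunComposition (mseq τ η)).index (blockPos hτ η x)

lemma runIdx_mono (hτ : IsOSP univ τ) {x y : Fin n} (h : blockIdx τ x ≤ blockIdx τ y) :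
    runIdx hτ η x ≤ runIdx hτ η y :=
  index_mono _ h

/-- A coarsening of `τ` refines `η` iff each of its blocks stays within one level run. -/
lemma refines_iff_runIdx_eq (hτ : IsOSP univ τ) (hη : IsOSP univ η) (hbar : refines τ η)
    (hσ : IsOSP univ σ) (hle : OSPle τ σ) :
    refines σ η ↔ ∀ x y, blockIdx σ x = blockIdx σ y → runIdx hτ η x = runIdx hτ η y := by
  rw [hτ.OSPle_iff hσ] at hle
  constructor
  · intro hr
    rw [hσ.refines_iff hη] at hr
    have key : ∀ x y, blockIdx τ x ≤ blockIdx τ y → blockIdx σ x = blockIdx σ y →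
        runIdx hτ η x = runIdx hτ η y := by
      intro x y hxy he
      refine index_eq_of_forall_getElem_eq (l := mseq τ η) hxy (blockPos hτ η y).2 ?_
      intro i h1 h2
      obtain ⟨z, hz⟩ := blockPos_surjective hτ η ⟨i, h2.trans_lt (blockPos hτ η y).2⟩
      have hz' : blockIdx τ z = i := congrArg Fin.val hz
      have hzx : blockIdx σ z = blockIdx σ x :=
        le_antisymm ((hle z y (by omega)).trans he.ge) (hle x z (by omega))
      have e1 := getElem_blockPos hτ hη hbar z
      have e2 := getElem_blockPos hτ hη hbar x
      exact (congrArg (fun p : Fin _ => (mseq τ η)[p]) hz).symm.trans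
        (e1.trans ((hr z x hzx).trans e2.symm))
    intro x y he
    rcases le_total (blockIdx τ x) (blockIdx τ y) with h | h
    · exact key x y h he
    · exact (key y x h he.symm).symm
  · intro h
    rw [hσ.refines_iff hη]
    intro x y he
    rw [← getElem_blockPos hτ hη hbar x, ← getElem_blockPos hτ hη hbar y]
    exact getElem_eq_of_index_eq (h x y he)

/-- A coarsening of `τ` refines `η` iff it lies below the level-run partition. -/
lemma OSPle_kernel_runIdx_iff (hτ : IsOSP univ τ) (hη : IsOSP univ η) (hbar : refines τ η)
    (hσ : IsOSP univ σ) (hle : OSPle τ σ) :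
    OSPle σ (kernel fun x => (runIdx hτ η x : ℕ)) ↔ refines σ η := by
  have hk := isOSP_kernel fun x => (runIdx hτ η x : ℕ)
  have hτk : OSPle τ (kernel fun x => (runIdx hτ η x : ℕ)) :=
    hτ.OSPle_of_blockIdx_le hk fun x y h =>
      (blockIdx_kernel_le_iff _ x y).2 (runIdx_mono hτ h)
  have h1 : OSPle σ (kernel fun x => (runIdx hτ η x : ℕ)) ↔
      refines σ (kernel fun x => (runIdx hτ η x : ℕ)) :=
    ⟨hσ.refines_of_OSPle hk, hτ.OSPle_of_refines hσ hk hle hτk⟩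
  rw [h1, hσ.refines_iff hk, refines_iff_runIdx_eq hτ hη hbar hσ hle]
  simp only [blockIdx_kernel_eq_iff, Fin.val_inj]

/-- An element of the block of `τ` at position `k` of the `j`-th level run. -/
noncomputable def runRep (hτ : IsOSP univ τ) (η : List (Block n))
    (j : Fin (levelRunComposition (mseq τ η)).length)
    (k : Fin ((levelRunComposition (mseq τ η)).blocksFun j)) : Fin n :=
  Function.surjInv (blockPos_surjective hτ η) ((levelRunComposition (mseq τ η)).embedding j k)

lemma blockPos_runRep (hτ : IsOSP univ τ) (j : Fin (levelRunComposition (mseq τ η)).length)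
    (k : Fin ((levelRunComposition (mseq τ η)).blocksFun j)) :
    blockPos hτ η (runRep hτ η j k) = (levelRunComposition (mseq τ η)).embedding j k :=
  Function.surjInv_eq _ _

lemma blockIdx_runRep_le (hτ : IsOSP univ τ) {j : Fin (levelRunComposition (mseq τ η)).length}
    {k k' : Fin ((levelRunComposition (mseq τ η)).blocksFun j)} (h : k ≤ k') :
    blockIdx τ (runRep hτ η j k) ≤ blockIdx τ (runRep hτ η j k') := by
  have : blockPos hτ η (runRep hτ η j k) ≤ blockPos hτ η (runRep hτ η j k') := by
    rw [blockPos_runRep, blockPos_runRep]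
    exact ((levelRunComposition (mseq τ η)).embedding j).monotone h
  exact this

lemma exists_blockIdx_runRep_eq (hτ : IsOSP univ τ) (x : Fin n) :
    ∃ k, blockIdx τ (runRep hτ η (runIdx hτ η x) k) = blockIdx τ x := by
  refine ⟨(levelRunComposition (mseq τ η)).invEmbedding (blockPos hτ η x), ?_⟩
  have := blockPos_runRep hτ _ ((levelRunComposition (mseq τ η)).invEmbedding (blockPos hτ η x))
  rw [Composition.embedding_comp_inv] at this
  exact congrArg Fin.val this

/-- The trace of an ordered set partition on the `j`-th level run. -/
noncomputable def runTrace (hτ : IsOSP univ τ) (η σ : List (Block n))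
    (j : Fin (levelRunComposition (mseq τ η)).length) :
    List (Finset (Fin ((levelRunComposition (mseq τ η)).blocksFun j))) :=
  kernel fun k => blockIdx σ (runRep hτ η j k)

lemma isIP_runTrace (hτ : IsOSP univ τ) (hσ : IsOSP univ σ) (hle : OSPle τ σ)
    (j : Fin (levelRunComposition (mseq τ η)).length) : IsIP (runTrace hτ η σ j) := by
  refine isIP_iff.2 ⟨isOSP_kernel _, fun k k' hk => ?_⟩
  exact (blockIdx_kernel_le_iff _ _ _).2
    (hτ.blockIdx_le_of_OSPle hσ hle (blockIdx_runRep_le hτ hk))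

lemma OSPle_iff_forall_refines_runTrace {σ' : List (Block n)} (hτ : IsOSP univ τ)
    (hη : IsOSP univ η) (hbar : refines τ η) (hσ : IsOSP univ σ) (hσ' : IsOSP univ σ')
    (hle : OSPle τ σ) (hle' : OSPle τ σ') (hr : refines σ η) :
    OSPle σ σ' ↔ ∀ j, refines (runTrace hτ η σ j) (runTrace hτ η σ' j) := by
  have h1 : OSPle σ σ' ↔ refines σ σ' :=
    ⟨hσ.refines_of_OSPle hσ', hτ.OSPle_of_refines hσ hσ' hle hle'⟩
  have h2 : ∀ j, refines (runTrace hτ η σ j) (runTrace hτ η σ' j) ↔ ∀ k k',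
      blockIdx σ (runRep hτ η j k) = blockIdx σ (runRep hτ η j k') →
        blockIdx σ' (runRep hτ η j k) = blockIdx σ' (runRep hτ η j k') := by
    intro j
    rw [runTrace, runTrace, (isOSP_kernel _).refines_iff (isOSP_kernel _)]
    simp only [blockIdx_kernel_eq_iff]
  rw [h1, hσ.refines_iff hσ', forall_congr' h2]
  refine ⟨fun h j k k' => h _ _, fun h x y he => ?_⟩
  have hrun := (refines_iff_runIdx_eq hτ hη hbar hσ hle).1 hr x y he
  obtain ⟨k, hk⟩ := exists_blockIdx_runRep_eq (η := η) hτ x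
  have hy := exists_blockIdx_runRep_eq (η := η) hτ y
  rw [← hrun] at hy
  obtain ⟨k', hk'⟩ := hy
  have hcongr : ∀ {ρ : List (Block n)}, IsOSP univ ρ → OSPle τ ρ → ∀ {a b : Fin n},
      blockIdx τ a = blockIdx τ b → blockIdx ρ a = blockIdx ρ b :=
    fun {ρ} hρ hleρ {a b} hab => (hτ.refines_iff hρ).1 (hτ.refines_of_OSPle hρ hleρ) a b hab
  rw [← hcongr hσ' hle' hk, ← hcongr hσ' hle' hk']
  apply h
  rw [hcongr hσ hle hk, hcongr hσ hle hk', he]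

lemma exists_runTrace_eq (hτ : IsOSP univ τ) (hη : IsOSP univ η) (hbar : refines τ η)
    (l : ∀ j : Fin (levelRunComposition (mseq τ η)).length,
      List (Finset (Fin ((levelRunComposition (mseq τ η)).blocksFun j))))
    (hl : ∀ j, IsIP (l j)) :
    ∃ σ, IsOSP univ σ ∧ OSPle τ σ ∧ refines σ η ∧ ∀ j, runTrace hτ η σ j = l j := by
  let c := levelRunComposition (mseq τ η)
  let N := ∑ j, (l j).length + 1
  have hN : ∀ j k, blockIdx (l j) k < N := fun j k => Nat.lt_succ_of_le
    (((hl j).1.blockIdx_lt k).le.trans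
      (single_le_sum (f := fun j => (l j).length) (fun _ _ => Nat.zero_le _) (mem_univ j)))
  let v : (Σ j, Fin (c.blocksFun j)) → ℕ := fun u => u.1 * N + blockIdx (l u.1) u.2
  let f : Fin n → ℕ := fun x => v (c.blocksFinEquiv.symm (blockPos hτ η x))
  have hdiv : ∀ u, v u / N = u.1 := fun u => by
    have hlt := hN u.1 u.2
    change ((u.1 : ℕ) * N + blockIdx (l u.1) u.2) / N = u.1
    rw [Nat.mul_comm, Nat.mul_add_div (Nat.zero_lt_of_lt hlt), Nat.div_eq_of_lt hlt, add_zero]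
  have hfrun : ∀ x, f x / N = runIdx hτ η x := fun x => hdiv _
  have hfrep : ∀ j k, f (runRep hτ η j k) = v ⟨j, k⟩ := fun j k => by
    have : blockPos hτ η (runRep hτ η j k) = c.blocksFinEquiv ⟨j, k⟩ := blockPos_runRep hτ j k
    simp only [f, this, Equiv.symm_apply_apply]
  have hvmono : ∀ u u', c.blocksFinEquiv u ≤ c.blocksFinEquiv u' → v u ≤ v u' := by
    rintro ⟨j, k⟩ ⟨j', k'⟩ h
    have hj : j ≤ j' := by
      have := index_mono c h
      rwa [show c.blocksFinEquiv ⟨j, k⟩ = c.embedding j k from rfl,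
        show c.blocksFinEquiv ⟨j', k'⟩ = c.embedding j' k' from rfl,
        c.index_embedding, c.index_embedding] at this
    rcases hj.eq_or_lt with rfl | hlt
    · exact Nat.add_le_add_left ((isIP_iff.1 (hl j)).2 k k' ((c.embedding j).le_iff_le.1 h)) _
    · have := hN j k
      have := Nat.mul_le_mul_right N (Nat.succ_le_of_lt (Fin.lt_def.1 hlt))
      rw [Nat.succ_mul] at this
      simp only [v]
      omega
  have hσ := isOSP_kernel f
  have hle : OSPle τ (kernel f) := hτ.OSPle_of_blockIdx_le hσ fun x y hxy => by
    rw [blockIdx_kernel_le_iff]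
    refine hvmono _ _ ?_
    rw [Equiv.apply_symm_apply, Equiv.apply_symm_apply]
    exact hxy
  refine ⟨kernel f, hσ, hle, ?_, fun j => ?_⟩
  · refine (refines_iff_runIdx_eq hτ hη hbar hσ hle).2 fun x y hxy => ?_
    rw [blockIdx_kernel_eq_iff] at hxy
    exact Fin.ext (by rw [← hfrun, ← hfrun, hxy])
  · refine (isOSP_kernel _).eq_of_blockIdx_le_iff (hl j).1 fun k k' => ?_
    rw [blockIdx_kernel_le_iff, blockIdx_kernel_le_iff, hfrep, hfrep]
    exact Nat.add_le_add_iff_left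

end Coarsenings

/-- Let `τ, η ∈ OP_n` with `τ̄ ≤ η̄`. Then there is `σ_max ∈ OP_n` with
`{σ ∈ OP_n : σ ≥ τ and σ̄ ≤ η̄} = {σ ∈ OP_n : τ ≤ σ ≤ σ_max}`; moreover this set (with the
induced order) is order-isomorphic to the product poset `IP_{q₁} × ⋯ × IP_{q_r}`, where
`q₁,…,q_r` are the lengths of the level runs of `(m₁,…,m_s)` and `r = |τ| − plat_η(τ)`. -/
theorem statement14 {n : ℕ} (τ η : List (Block n))
    (hτ : IsOSP Finset.univ τ) (hη : IsOSP Finset.univ η) (hbar : refines τ η) :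
    ∃ σmax : List (Block n), IsOSP Finset.univ σmax ∧
      ({σ : List (Block n) | IsOSP Finset.univ σ ∧ OSPle τ σ ∧ refines σ η}
        = {σ : List (Block n) | IsOSP Finset.univ σ ∧ OSPle τ σ ∧ OSPle σ σmax}) ∧
      (levelRunLengths (mseq τ η)).length = τ.length - platN τ η ∧
      ∃ Φ : {σ : List (Block n) // IsOSP Finset.univ σ ∧ OSPle τ σ ∧ refines σ η} →
          ((j : Fin (levelRunLengths (mseq τ η)).length) →
            {l : List (Finset (Fin ((levelRunLengths (mseq τ η)).get j))) // IsIP l}),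
        Function.Bijective Φ ∧
        ∀ σ σ', OSPle σ.val σ'.val ↔ ∀ j, refines ((Φ σ) j).val ((Φ σ') j).val := by
  have hmax := isOSP_kernel fun x => (runIdx hτ η x : ℕ)
  refine ⟨_, hmax, ?_, ?_, fun σ j => ⟨runTrace hτ η σ.1 j, isIP_runTrace hτ σ.2.1 σ.2.2.1 j⟩,
    ⟨?_, ?_⟩, ?_⟩
  · ext σ
    exact and_congr_right fun hσ => and_congr_right fun hle =>
      (OSPle_kernel_runIdx_iff hτ hη hbar hσ hle).symm
  · rw [length_levelRunLengths, length_mseq, platN]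
  · intro σ σ' h
    have hr : ∀ j, runTrace hτ η σ.1 j = runTrace hτ η σ'.1 j := fun j =>
      congrArg Subtype.val (congrFun h j)
    have h1 : OSPle σ.1 σ'.1 := (OSPle_iff_forall_refines_runTrace hτ hη hbar σ.2.1 σ'.2.1
      σ.2.2.1 σ'.2.2.1 σ.2.2.2).2 fun j P hP => ⟨P, hr j ▸ hP, Subset.rfl⟩
    have h2 : OSPle σ'.1 σ.1 := (OSPle_iff_forall_refines_runTrace hτ hη hbar σ'.2.1 σ.2.1
      σ'.2.2.1 σ.2.2.1 σ'.2.2.2).2 fun j P hP => ⟨P, (hr j).symm ▸ hP, Subset.rfl⟩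
    exact Subtype.ext (σ.2.1.eq_of_blockIdx_le_iff σ'.2.1 fun x y =>
      ⟨σ.2.1.blockIdx_le_of_OSPle σ'.2.1 h1, σ'.2.1.blockIdx_le_of_OSPle σ.2.1 h2⟩)
  · intro l
    obtain ⟨σ, hσ, hle, hr, h⟩ := exists_runTrace_eq hτ hη hbar
      (fun j => (l j).1) (fun j => (l j).2)
    exact ⟨⟨σ, hσ, hle, hr⟩, funext fun j => Subtype.ext (h j)⟩
  · intro σ σ'
    exact OSPle_iff_forall_refines_runTrace hτ hη hbar σ.2.1 σ'.2.1 σ.2.2.1 σ'.2.2.1 σ.2.2.2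

end OSPpaper
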